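/- Under the featured correlated Gaussian Wigner model G(n,d,ρ,r), suppose d = ω(log n) and n·log(1/(1−ρ²)) + d·log(1/(1−r²)) ≥ (4+ε)·log n for some constant ε > 0. Then there exists an estimator π̂ = π̂(G1,G2) (one may take the maximum likelihood estimator π̂ ∈ argmax_{π∈S_n} S_π(G1,G2)) such that for every π* ∈ S_n, P[overlap(π̂, π*) = 1] = 1 − o(1) as n → ∞; that is, π̂ exactly recovers π* with probability tending to one. -/

import Mathlib

open MeasureTheory ProbabilityTheory Filter
open scoped ENNReal

namespace FCGW

/-- `phi x = x / (1 - x^2)`, the weight function `φ` from the paper. -/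
noncomputable def phi (x : ℝ) : ℝ := x / (1 - x ^ 2)

/-- The edge set of the complete graph on `Fin n`: non-diagonal unordered pairs. -/
abbrev Edge (n : ℕ) := {e : Sym2 (Fin n) // ¬ e.IsDiag}

lemma map_not_isDiag {n : ℕ} (π : Equiv.Perm (Fin n)) (e : Sym2 (Fin n)) :
    ¬ e.IsDiag → ¬ (Sym2.map π e).IsDiag := by
  induction e using Sym2.ind with
  | _ x y =>
    simp only [Sym2.map_pair_eq, Sym2.mk_isDiag_iff]
    exact fun he h => he (π.injective h)

/-- Action of a vertex permutation on edges: `π({u,v}) = {π(u), π(v)}`. -/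
def edgeMap {n : ℕ} (π : Equiv.Perm (Fin n)) (e : Edge n) : Edge n :=
  ⟨Sym2.map π e.1, map_not_isDiag π e.1 e.2⟩

/-- The observation space: edge weights of `G1`, edge weights of `G2`,
features of `G1`, features of `G2`. -/
abbrev Obs (n d : ℕ) :=
  (Edge n → ℝ) × (Edge n → ℝ) × (Fin n → Fin d → ℝ) × (Fin n → Fin d → ℝ)

/-- The law of a pair of jointly Gaussian standard normals with correlation `ρ`,
i.e. a centered Gaussian vector in `ℝ²` with covariance `[[1, ρ], [ρ, 1]]`. -/
noncomputable def gaussianPair (ρ : ℝ) : Measure (ℝ × ℝ) :=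
  Measure.map (fun z : ℝ × ℝ => (z.1, ρ * z.1 + Real.sqrt (1 - ρ ^ 2) * z.2))
    ((gaussianReal 0 1).prod (gaussianReal 0 1))

/-- The law `N(0, Σ_d)` with `Σ_d = [[I_d, r I_d], [r I_d, I_d]]` of a correlated
feature pair `(x, y) ∈ ℝ^d × ℝ^d`. -/
noncomputable def featurePair (d : ℕ) (r : ℝ) : Measure ((Fin d → ℝ) × (Fin d → ℝ)) :=
  Measure.map (fun z : (Fin d → ℝ) × (Fin d → ℝ) =>
      (z.1, fun i => r * z.1 i + Real.sqrt (1 - r ^ 2) * z.2 i))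
    ((Measure.pi fun _ : Fin d => gaussianReal 0 1).prod
      (Measure.pi fun _ : Fin d => gaussianReal 0 1))

/-- The underlying randomness of the featured correlated Gaussian Wigner model:
independent correlated Gaussian pairs for each edge of `G1` and independent
correlated feature pairs for each vertex of `G1`. -/
noncomputable def sample (n d : ℕ) (ρ r : ℝ) :
    Measure ((Edge n → ℝ × ℝ) × (Fin n → (Fin d → ℝ) × (Fin d → ℝ))) :=
  (Measure.pi fun _ : Edge n => gaussianPair ρ).prod
    (Measure.pi fun _ : Fin n => featurePair d r)

/-- The observations `(β(G1), β(G2), x, y)` produced from the underlying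
randomness when the latent vertex correspondence is `πs`: the pair at edge `e`
gives the weight of `e` in `G1` and of `πs(e)` in `G2`, and the feature pair at a
vertex `v` gives the feature of `v` in `G1` and of `πs(v)` in `G2`. -/
noncomputable def obsOf {n d : ℕ} (πs : Equiv.Perm (Fin n))
    (ω : (Edge n → ℝ × ℝ) × (Fin n → (Fin d → ℝ) × (Fin d → ℝ))) : Obs n d :=
  (fun e => (ω.1 e).1,
   fun f => (ω.1 (edgeMap πs⁻¹ f)).2,
   fun v => (ω.2 v).1,
   fun v => (ω.2 (πs⁻¹ v)).2)

/-- The law of the observed pair of featured graphs `(G1, G2)` under the featured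
correlated Gaussian Wigner model `G(n, d, ρ, r)` with latent correspondence `πs`. -/
noncomputable def obsLaw (n d : ℕ) (ρ r : ℝ) (πs : Equiv.Perm (Fin n)) :
    Measure (Obs n d) :=
  Measure.map (obsOf πs) (sample n d ρ r)

/-- The similarity score
`S_π = φ(ρ) Σ_e β_e(G1) β_{π(e)}(G2) + φ(r) Σ_v ⟪x_v, y_{π(v)}⟫`. -/
noncomputable def score {n d : ℕ} (ρ r : ℝ) (o : Obs n d) (π : Equiv.Perm (Fin n)) : ℝ :=
  phi ρ * ∑ e : Edge n, o.1 e * o.2.1 (edgeMap π e)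
    + phi r * ∑ v : Fin n, ∑ i : Fin d, o.2.2.1 v i * o.2.2.2 (π v) i

/-- `overlap(π, π') = |{v : π v = π' v}| / n`. -/
noncomputable def overlap {n : ℕ} (π π' : Equiv.Perm (Fin n)) : ℝ :=
  ((Finset.univ.filter fun v => π v = π' v).card : ℝ) / n

/-- The Hamming distance `d(π, π') = |{v : π v ≠ π' v}|`. -/
def hamming {n : ℕ} (π π' : Equiv.Perm (Fin n)) : ℕ :=
  (Finset.univ.filter fun v => π v ≠ π' v).card

instance {n : ℕ} : MeasurableSpace (Equiv.Perm (Fin n)) := ⊤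

/-- The Bayesian joint law of `(π*, (G1, G2))` when `π*` is uniform on `S_n`. -/
noncomputable def bayesLaw (n d : ℕ) (ρ r : ℝ) :
    Measure (Equiv.Perm (Fin n) × Obs n d) :=
  (Nat.factorial n : ℝ≥0∞)⁻¹ •
    ∑ π : Equiv.Perm (Fin n), Measure.map (fun o => (π, o)) (obsLaw n d ρ r π)

lemma lint_exp_lin (c : ℝ) :
    ∫⁻ x, ENNReal.ofReal (Real.exp (c * x)) ∂(gaussianReal 0 1) = ENNReal.ofReal (Real.exp (c ^ 2 / 2)) := by
  rw [← ofReal_integral_eq_lintegral_ofReal (integrable_exp_mul_gaussianReal c)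
    (ae_of_all _ fun x => (Real.exp_pos _).le)]
  have := mgf_gaussianReal (p := gaussianReal 0 1) (X := id) (μ := 0) (v := 1) (by simp) c
  simp only [mgf, id] at this
  rw [this]; congr 2; simp

lemma lint_exp_sq (l : ℝ) (hl : l < 1) :
    ∫⁻ x, ENNReal.ofReal (Real.exp (l / 2 * x ^ 2)) ∂(gaussianReal 0 1)
      = ENNReal.ofReal (Real.exp (-(1 / 2) * Real.log (1 - l))) := by
  have hl' : 0 < 1 - l := by linarith
  rw [gaussianReal_of_var_ne_zero 0 one_ne_zero,
    lintegral_withDensity_eq_lintegral_mul _ (measurable_gaussianPDF 0 1) (by fun_prop)]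
  have h1 : ∀ x : ℝ, (gaussianPDF 0 1 * fun x => ENNReal.ofReal (Real.exp (l / 2 * x ^ 2))) x
      = ENNReal.ofReal ((√(2 * Real.pi))⁻¹ * Real.exp (-((1 - l) / 2) * x ^ 2)) := by
    intro x
    simp only [Pi.mul_apply, gaussianPDF, gaussianPDFReal]
    rw [← ENNReal.ofReal_mul (by positivity), mul_assoc, ← Real.exp_add]
    congr 2
    · simp
    · congr 1; simp; ring
  simp_rw [h1]
  rw [← ofReal_integral_eq_lintegral_ofReal
    ((integrable_exp_neg_mul_sq (by positivity)).const_mul _) (ae_of_all _ fun x => by positivity),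
    integral_const_mul, integral_gaussian]
  congr 1
  rw [← Real.sqrt_inv, ← Real.sqrt_mul (by positivity)]
  have : (2 * Real.pi)⁻¹ * (Real.pi / ((1 - l) / 2)) = (1 - l)⁻¹ := by
    field_simp
  rw [this, Real.sqrt_eq_rpow, Real.rpow_def_of_pos (by positivity), Real.log_inv]
  congr 1; ring

lemma lint_pi {ι : Type*} [Fintype ι] (f : ι → ℝ → ℝ≥0∞) (hf : ∀ i, Measurable (f i)) :
    ∫⁻ x, ∏ i, f i (x i) ∂(Measure.pi fun _ : ι => gaussianReal 0 1)
      = ∏ i, ∫⁻ t, f i t ∂(gaussianReal 0 1) := by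
  have hi : iIndepFun (fun i (x : ι → ℝ) => f i (x i)) (Measure.pi fun _ : ι => gaussianReal 0 1) :=
    iIndepFun_pi (fun i => (hf i).aemeasurable)
  rw [lintegral_prod_eq_prod_lintegral_of_indepFun _ _ hi (fun i => by fun_prop)]
  refine Finset.prod_congr rfl fun i _ => ?_
  exact (measurePreserving_eval (fun _ : ι => gaussianReal 0 1) i).lintegral_comp (hf i)

open Matrix in
lemma quad {ι : Type*} [Fintype ι] [DecidableEq ι] (B : Matrix ι ι ℝ) (hB : B.IsHermitian)
    (lo hi p q : ℝ) (hlo : ∀ x : ι → ℝ, lo * ∑ i, x i ^ 2 ≤ x ⬝ᵥ B *ᵥ x)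
    (hhi : ∀ x : ι → ℝ, x ⬝ᵥ B *ᵥ x ≤ hi * ∑ i, x i ^ 2) (h1 : hi < 1)
    (hpq : ∀ l, lo ≤ l → l ≤ hi → -(1 / 2) * Real.log (1 - l) ≤ p + q * l) :
    ∫⁻ x, ENNReal.ofReal (Real.exp (1 / 2 * (x ⬝ᵥ B *ᵥ x))) ∂(Measure.pi fun _ : ι => gaussianReal 0 1)
      ≤ ENNReal.ofReal (Real.exp (p * Fintype.card ι + q * B.trace)) := by
  classical
  set b := hB.eigenvectorBasis with hb
  set lam := hB.eigenvalues with hlam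
  have horth : ∀ i j, (b i).ofLp ⬝ᵥ (b j).ofLp = if i = j then 1 else 0 := by
    intro i j
    have := orthonormal_iff_ite.mp b.orthonormal i j
    rw [← this, EuclideanSpace.inner_eq_star_dotProduct, dotProduct_comm]
    simp
  have hev : ∀ j, B *ᵥ (b j).ofLp = lam j • (b j).ofLp := hB.mulVec_eigenvectorBasis
  have hmv : ∀ y : ι → ℝ, B *ᵥ (∑ i, y i • (b i).ofLp) = ∑ i, (y i * lam i) • (b i).ofLp := by
    intro y
    rw [mulVec_sum]
    refine Finset.sum_congr rfl fun i _ => ?_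
    rw [mulVec_smul, hev, smul_smul]
  have hdot : ∀ y z : ι → ℝ, (∑ i, y i • (b i).ofLp) ⬝ᵥ (∑ i, z i • (b i).ofLp) = ∑ i, y i * z i := by
    intro y z
    simp [sum_dotProduct, dotProduct_sum, horth, mul_comm]
  have hlam_eq : ∀ j, (b j).ofLp ⬝ᵥ B *ᵥ (b j).ofLp = lam j := by
    intro j; rw [hev, dotProduct_smul, horth]; simp
  have hone : ∀ j, ∑ i, (b j).ofLp i ^ 2 = 1 := by
    intro j
    have := horth j j
    simp only [dotProduct, if_true] at this
    rw [← this]; exact Finset.sum_congr rfl fun i _ => by ring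
  have hl1 : ∀ j, lo ≤ lam j := fun j => by
    have := hlo (b j).ofLp; rw [hlam_eq, hone] at this; linarith
  have hl2 : ∀ j, lam j ≤ hi := fun j => by
    have := hhi (b j).ofLp; rw [hlam_eq, hone] at this; linarith
  have hmap : (Measure.pi fun _ : ι => gaussianReal 0 1) =
      (Measure.pi fun _ : ι => gaussianReal 0 1).map (fun y : ι → ℝ => ∑ i, y i • (b i).ofLp) := by
    have e1 := map_pi_eq_stdGaussian (ι := ι)
    have e2 := stdGaussian_eq_map_pi_orthonormalBasis b
    rw [← e1] at e2
    have e3 := congrArg (Measure.map (WithLp.ofLp (p := 2))) e2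
    rw [Measure.map_map (by fun_prop) (by fun_prop), Measure.map_map (by fun_prop) (by fun_prop)] at e3
    have e4 : (WithLp.ofLp (p := 2)) ∘ (WithLp.toLp 2 : (ι → ℝ) → _) = id := rfl
    rw [e4, Measure.map_id] at e3
    rw [e3]
    congr 1
    ext y i
    simp
  rw [hmap, lintegral_map (by unfold dotProduct mulVec dotProduct; fun_prop) (by fun_prop)]
  have hint : ∀ y : ι → ℝ, ENNReal.ofReal (Real.exp (1 / 2 * ((∑ i, y i • (b i).ofLp) ⬝ᵥ B *ᵥ (∑ i, y i • (b i).ofLp))))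
      = ∏ i, ENNReal.ofReal (Real.exp (lam i / 2 * (y i) ^ 2)) := by
    intro y
    rw [hmv, hdot, ← ENNReal.ofReal_prod_of_nonneg (fun _ _ => (Real.exp_pos _).le), ← Real.exp_sum,
      Finset.mul_sum]
    congr 3; ext i; ring
  simp_rw [hint]
  rw [lint_pi (fun i t => ENNReal.ofReal (Real.exp (lam i / 2 * t ^ 2))) (fun i => by fun_prop)]
  simp_rw [fun i => lint_exp_sq (lam i) (lt_of_le_of_lt (hl2 i) h1)]
  rw [← ENNReal.ofReal_prod_of_nonneg (fun _ _ => (Real.exp_pos _).le), ← Real.exp_sum]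
  apply ENNReal.ofReal_le_ofReal
  apply Real.exp_le_exp.mpr
  have htr : B.trace = ∑ i, lam i := by
    rw [hB.trace_eq_sum_eigenvalues]; simp [hlam]
  rw [htr, Finset.mul_sum]
  calc _ ≤ ∑ i, (p + q * lam i) := Finset.sum_le_sum fun i _ => hpq _ (hl1 i) (hl2 i)
    _ = _ := by rw [Finset.sum_add_distrib]; simp [mul_comm]

instance (ρ : ℝ) : IsProbabilityMeasure (gaussianPair ρ) :=
  Measure.isProbabilityMeasure_map (by fun_prop)

lemma lint_gpair {ι : Type*} [Fintype ι] (ρ : ℝ) (F : (ι → ℝ × ℝ) → ℝ≥0∞) (hF : Measurable F) :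
    ∫⁻ ω, F ω ∂(Measure.pi fun _ : ι => gaussianPair ρ)
      = ∫⁻ x, ∫⁻ z, F (fun i => (x i, ρ * x i + Real.sqrt (1 - ρ ^ 2) * z i))
        ∂(Measure.pi fun _ : ι => gaussianReal 0 1) ∂(Measure.pi fun _ : ι => gaussianReal 0 1) := by
  unfold gaussianPair
  rw [← Measure.pi_map_pi (fun i => by fun_prop), lintegral_map hF (by fun_prop)]
  have hm := (measurePreserving_arrowProdEquivProdArrow ℝ ℝ ι (fun _ => gaussianReal 0 1)
    (fun _ => gaussianReal 0 1)).symm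
  rw [← hm.lintegral_comp (by fun_prop), lintegral_prod _ (by
    refine (Measurable.comp (g := fun a : ι → ℝ × ℝ => F fun i => ((a i).1, ρ * (a i).1 + Real.sqrt (1 - ρ ^ 2) * (a i).2)) (by fun_prop) hm.measurable).aemeasurable)]
  rfl

lemma pairMGF {ι : Type*} [Fintype ι] (σ : Equiv.Perm ι) (w : ι → ℝ)
    (hw : ∀ i, w i ^ 2 = w i) (hσ : ∀ i, w (σ i) = w i) (ρ a b : ℝ) (h0 : 0 < ρ) (h1 : ρ < 1) :
    ∫⁻ ω, ENNReal.ofReal (Real.exp (∑ i, w i * (a * ((ω i).1 * (ω (σ i)).2) + b * ((ω i).1 * (ω i).2))))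
        ∂(Measure.pi fun _ : ι => gaussianPair ρ)
      = ∫⁻ x, ENNReal.ofReal (Real.exp (∑ i, w i * ((ρ * a + (1 - ρ ^ 2) * (a * b)) * (x i * x (σ i))
          + (ρ * b + (1 - ρ ^ 2) * (a ^ 2 + b ^ 2) / 2) * x i ^ 2)))
          ∂(Measure.pi fun _ : ι => gaussianReal 0 1) := by
  rw [lint_gpair _ _ (by fun_prop)]
  have hs : Real.sqrt (1 - ρ ^ 2) ^ 2 = 1 - ρ ^ 2 := Real.sq_sqrt (by nlinarith)
  set s := Real.sqrt (1 - ρ ^ 2)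
  refine lintegral_congr fun x => ?_
  have key : ∀ y : ι → ℝ, ∑ i, w i * (a * (x i * y (σ i)) + b * (x i * y i))
      = ∑ i, (w i * (a * x (σ.symm i) + b * x i)) * y i := by
    intro y
    have : ∑ i, w i * (a * (x i * y (σ i))) = ∑ i, w i * (a * (x (σ.symm i) * y i)) := by
      rw [← Equiv.sum_comp σ (fun i => w i * (a * (x (σ.symm i) * y i)))]
      simp [hσ]
    simp only [mul_add, add_mul, Finset.sum_add_distrib]
    rw [this]
    congr 1 <;> exact Finset.sum_congr rfl fun i _ => by ring
  have h2 : ∀ z : ι → ℝ, ENNReal.ofReal (Real.exp (∑ i, w i * (a * (x i * (ρ * x (σ i) + s * z (σ i))) + b * (x i * (ρ * x i + s * z i)))))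
      = ENNReal.ofReal (Real.exp (∑ i, (w i * (a * x (σ.symm i) + b * x i)) * (ρ * x i)))
        * ∏ i, ENNReal.ofReal (Real.exp ((w i * (a * x (σ.symm i) + b * x i) * s) * z i)) := by
    intro z
    rw [key (fun i => ρ * x i + s * z i), ← ENNReal.ofReal_prod_of_nonneg (fun _ _ => (Real.exp_pos _).le),
      ← ENNReal.ofReal_mul (Real.exp_pos _).le, ← Real.exp_sum, ← Real.exp_add, ← Finset.sum_add_distrib]
    congr 3; ext i; ring
  simp only [h2]
  rw [lintegral_const_mul _ (by fun_prop),
    lint_pi (fun i t => ENNReal.ofReal (Real.exp ((w i * (a * x (σ.symm i) + b * x i) * s) * t))) (fun i => by fun_prop)]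
  simp_rw [lint_exp_lin]
  rw [← ENNReal.ofReal_prod_of_nonneg (fun _ _ => (Real.exp_pos _).le),
      ← ENNReal.ofReal_mul (Real.exp_pos _).le, ← Real.exp_sum, ← Real.exp_add, ← Finset.sum_add_distrib]
  congr 2
  have e1 : ∀ i, w i * (a * x (σ.symm i) + b * x i) * (ρ * x i) + (w i * (a * x (σ.symm i) + b * x i) * s) ^ 2 / 2
      = (w i * ((ρ * a + (1 - ρ ^ 2) * (a * b)) * (x i * x (σ.symm i)))
        + w i * ((1 - ρ ^ 2) * a ^ 2 / 2 * x (σ.symm i) ^ 2))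
        + w i * ((ρ * b + (1 - ρ ^ 2) * b ^ 2 / 2) * x i ^ 2) := by
    intro i
    have : (w i * (a * x (σ.symm i) + b * x i) * s) ^ 2 = w i ^ 2 * s ^ 2 * (a * x (σ.symm i) + b * x i) ^ 2 := by ring
    rw [this, hs, hw]; ring
  simp_rw [e1]
  rw [Finset.sum_add_distrib, ← Equiv.sum_comp σ (fun i => _ + w i * ((1 - ρ ^ 2) * a ^ 2 / 2 * x (σ.symm i) ^ 2)),
    ← Finset.sum_add_distrib]
  refine Finset.sum_congr rfl fun i _ => ?_
  simp only [hσ, Equiv.symm_apply_apply]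
  ring

open Matrix in
lemma quadσ {ι : Type*} [Fintype ι] [DecidableEq ι] (σ : Equiv.Perm ι) (w : ι → ℝ)
    (hw : ∀ i, w i ^ 2 = w i) (hσ : ∀ i, w (σ i) = w i) (u v lo hi p q : ℝ) (hu : 0 ≤ u)
    (hlo0 : lo ≤ 0) (hlo : lo ≤ 2 * (v - u)) (hhi0 : 0 ≤ hi) (hhi : 2 * (v + u) ≤ hi) (h1 : hi < 1)
    (hpq : ∀ l, lo ≤ l → l ≤ hi → -(1 / 2) * Real.log (1 - l) ≤ p + q * l) :
    ∫⁻ x, ENNReal.ofReal (Real.exp (∑ i, w i * (u * (x i * x (σ i)) + v * x i ^ 2)))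
          ∂(Measure.pi fun _ : ι => gaussianReal 0 1)
      ≤ ENNReal.ofReal (Real.exp (p * Fintype.card ι + q * (2 * (u * (∑ i with σ i = i, w i) + v * ∑ i, w i)))) := by
  set B : Matrix ι ι ℝ := Matrix.of fun i j =>
    u * ((if σ i = j then w i else 0) + (if σ j = i then w j else 0)) + 2 * v * (if i = j then w i else 0) with hBdef
  have hB : B.IsHermitian := by
    ext i j
    simp only [hBdef, conjTranspose_apply, of_apply, star_trivial]
    rw [add_comm (if σ j = i then w j else 0)]
    congr 2
    by_cases h : i = j
    · subst h; simp
    · simp [h, Ne.symm h]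
  have hq : ∀ x : ι → ℝ, x ⬝ᵥ B *ᵥ x = 2 * ∑ i, w i * (u * (x i * x (σ i)) + v * x i ^ 2) := by
    intro x
    have e : ∀ i j, x i * (B i j * x j) = (if σ i = j then u * w i * x i * x j else 0)
        + (if σ j = i then u * w j * x i * x j else 0) + (if i = j then 2 * v * w i * x i * x j else 0) := by
      intro i j
      simp only [hBdef, of_apply]
      split_ifs <;> ring
    simp only [dotProduct, mulVec, Finset.mul_sum, e, Finset.sum_add_distrib]
    rw [Finset.sum_comm (f := fun i j => if σ j = i then u * w j * x i * x j else 0)]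
    simp only [Finset.sum_ite_eq, Finset.mem_univ, if_true]
    rw [← Finset.sum_add_distrib, ← Finset.sum_add_distrib]
    refine Finset.sum_congr rfl fun i _ => by ring
  have htr : B.trace = 2 * (u * (∑ i with σ i = i, w i) + v * ∑ i, w i) := by
    simp only [Matrix.trace, diag_apply, hBdef, of_apply, if_true]
    rw [Finset.sum_filter, Finset.mul_sum, Finset.mul_sum, ← Finset.sum_add_distrib, Finset.mul_sum]
    refine Finset.sum_congr rfl fun i _ => by split_ifs <;> ring
  have hw0 : ∀ i, 0 ≤ w i := fun i => by rw [← hw i]; positivity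
  have hw1 : ∀ i, w i ≤ 1 := fun i => by nlinarith [hw i, hw0 i, sq_nonneg (w i - 1)]
  have hshift : ∀ x : ι → ℝ, ∑ i, w i * x (σ i) ^ 2 = ∑ i, w i * x i ^ 2 := by
    intro x
    rw [← Equiv.sum_comp σ (fun i => w i * x i ^ 2)]; simp [hσ]
  have hwx : ∀ x : ι → ℝ, ∑ i, w i * x i ^ 2 ≤ ∑ i, x i ^ 2 := fun x =>
    Finset.sum_le_sum fun i _ => by nlinarith [hw1 i, sq_nonneg (x i)]
  have hwx0 : ∀ x : ι → ℝ, 0 ≤ ∑ i, w i * x i ^ 2 := fun x =>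
    Finset.sum_nonneg fun i _ => mul_nonneg (hw0 i) (sq_nonneg _)
  have hsplit : ∀ x : ι → ℝ, ∑ i, w i * (u * (x i * x (σ i)) + v * x i ^ 2)
      = u * ∑ i, w i * (x i * x (σ i)) + v * ∑ i, w i * x i ^ 2 := by
    intro x
    rw [Finset.mul_sum, Finset.mul_sum, ← Finset.sum_add_distrib]
    exact Finset.sum_congr rfl fun i _ => by ring
  have hup : ∀ x : ι → ℝ, ∑ i, w i * (x i * x (σ i)) ≤ ∑ i, w i * x i ^ 2 := by
    intro x
    have : ∑ i, w i * (x i * x (σ i)) ≤ ∑ i, (w i * x i ^ 2 + w i * x (σ i) ^ 2) / 2 :=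
      Finset.sum_le_sum fun i _ => by nlinarith [mul_nonneg (hw0 i) (sq_nonneg (x i - x (σ i)))]
    rw [← Finset.sum_div, Finset.sum_add_distrib, hshift] at this
    linarith
  have hdn : ∀ x : ι → ℝ, -∑ i, w i * x i ^ 2 ≤ ∑ i, w i * (x i * x (σ i)) := by
    intro x
    have : ∑ i, -((w i * x i ^ 2 + w i * x (σ i) ^ 2) / 2) ≤ ∑ i, w i * (x i * x (σ i)) :=
      Finset.sum_le_sum fun i _ => by nlinarith [mul_nonneg (hw0 i) (sq_nonneg (x i + x (σ i)))]
    rw [Finset.sum_neg_distrib, ← Finset.sum_div, Finset.sum_add_distrib, hshift] at this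
    linarith
  have := quad B hB lo hi p q (fun x => by
      rw [hq, hsplit]
      nlinarith [hdn x, hwx x, hwx0 x, mul_le_mul_of_nonneg_left (hdn x) hu]) (fun x => by
      rw [hq, hsplit]
      nlinarith [hup x, hwx x, hwx0 x, mul_le_mul_of_nonneg_left (hup x) hu]) h1 hpq
  rw [htr] at this
  refine le_trans (le_of_eq ?_) this
  refine lintegral_congr fun x => ?_
  rw [hq]; congr 2; ring

/-- shorthand for `ρ² / (1 - ρ²)` -/
noncomputable def RR (x : ℝ) : ℝ := x ^ 2 / (1 - x ^ 2)

/-- shorthand for `-log (1 - ρ²)` -/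
noncomputable def LL (x : ℝ) : ℝ := Real.log (1 / (1 - x ^ 2))

lemma log_chord (m l : ℝ) (hm : 0 < m) (h1 : -m ≤ l) (h2 : l ≤ 0) :
    -(1 / 2) * Real.log (1 - l) ≤ 0 + Real.log (1 + m) / (2 * m) * l := by
  have hm1 : -l / m ≤ 1 := by rw [div_le_one hm]; linarith
  have hc0 := strictConcaveOn_log_Ioi.concaveOn.2
  have hc := hc0 (show (1 : ℝ) ∈ Set.Ioi 0 by simp) (show (1 + m) ∈ Set.Ioi (0 : ℝ) by simp; linarith)
    (show 0 ≤ 1 - (-l / m) by linarith) (show 0 ≤ -l / m from div_nonneg (by linarith) hm.le) (by ring)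
  simp only [smul_eq_mul, Real.log_one, mul_zero, zero_add] at hc
  have e : (1 - -l / m) * 1 + -l / m * (1 + m) = 1 - l := by field_simp; ring
  rw [e] at hc
  have : Real.log (1 + m) / (2 * m) * l = -(1 / 2) * (-l / m * Real.log (1 + m)) := by
    field_simp
  rw [this]; linarith

lemma log_quad (R l : ℝ) (hR : R ≤ 1 / 8) (h1 : -(3 * R) ≤ l) (h2 : l ≤ 3 * R) :
    -(1 / 2) * Real.log (1 - l) ≤ 9 * R ^ 2 + 1 / 2 * l := by
  have hl : 0 < 1 - l := by linarith
  have h := Real.one_sub_inv_le_log_of_pos hl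
  have : l ^ 2 ≤ 9 * R ^ 2 := by nlinarith
  have h3 : (1 - l)⁻¹ ≤ 1 + l + 2 * l ^ 2 := by
    rw [inv_le_iff_one_le_mul₀ hl]
    nlinarith [mul_nonneg (sq_nonneg l) (show 0 ≤ 1 - 2 * l by linarith)]
  linarith

section
variable {ι : Type*} [Fintype ι] [DecidableEq ι] (σ : Equiv.Perm ι) (w : ι → ℝ)

lemma case1 (ρ : ℝ) (h0 : 0 < ρ) (h1 : ρ < 1) :
    ∫⁻ ω, ENNReal.ofReal (Real.exp (∑ i, (1 : ℝ) * ((phi ρ / 2) * ((ω i).1 * (ω (σ i)).2) + (-(phi ρ / 2)) * ((ω i).1 * (ω i).2))))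
        ∂(Measure.pi fun _ : ι => gaussianPair ρ)
      ≤ ENNReal.ofReal (Real.exp (-(LL ρ / 4 * (Finset.univ.filter fun i => σ i ≠ i).card))) := by
  have hp : 0 < 1 - ρ ^ 2 := by nlinarith
  rw [pairMGF σ (fun _ => 1) (by simp) (by simp) ρ _ _ h0 h1]
  set c := ρ ^ 2 / (4 * (1 - ρ ^ 2)) with hc
  have hc0 : 0 < c := by positivity
  have hu : ρ * (phi ρ / 2) + (1 - ρ ^ 2) * (phi ρ / 2 * -(phi ρ / 2)) = c := by
    simp only [phi, hc]; field_simp; ring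
  have hv : ρ * -(phi ρ / 2) + (1 - ρ ^ 2) * ((phi ρ / 2) ^ 2 + (-(phi ρ / 2)) ^ 2) / 2 = -c := by
    simp only [phi, hc]; field_simp; ring
  rw [hu, hv]
  have h4 : LL ρ = Real.log (1 + 4 * c) := by
    unfold LL; congr 1; simp only [hc]; field_simp; ring
  refine (quadσ σ (fun _ => 1) (by simp) (by simp) c (-c) (-(4 * c)) 0 0 (Real.log (1 + 4 * c) / (2 * (4 * c))) hc0.le
    (by linarith) (by linarith) le_rfl (by linarith) one_pos
    (fun l => log_chord (4 * c) l (by linarith))).trans (le_of_eq ?_)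
  congr 2
  have hcard : ((Finset.univ.filter fun i => σ i = i).card : ℝ) + (Finset.univ.filter fun i => σ i ≠ i).card
      = Fintype.card ι := by
    rw [← Finset.card_univ, ← Finset.card_filter_add_card_filter_not (s := Finset.univ) (fun i => σ i = i)]
    push_cast; rfl
  simp only [Finset.sum_const, nsmul_eq_mul, mul_one, Finset.card_univ]
  rw [← hcard, h4]; field_simp; ring

lemma case2 (hw : ∀ i, w i ^ 2 = w i) (hσ : ∀ i, w (σ i) = w i)
    (ρ : ℝ) (h0 : 0 < ρ) (h1 : ρ < 1) (hR : RR ρ ≤ 1 / 8) :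
    ∫⁻ ω, ENNReal.ofReal (Real.exp (∑ i, w i * (phi ρ * ((ω i).1 * (ω (σ i)).2) + 0 * ((ω i).1 * (ω i).2))))
        ∂(Measure.pi fun _ : ι => gaussianPair ρ)
      ≤ ENNReal.ofReal (Real.exp (9 * RR ρ ^ 2 * Fintype.card ι + RR ρ * (∑ i with σ i = i, w i)
        + RR ρ / 2 * ∑ i, w i)) := by
  have hp : 0 < 1 - ρ ^ 2 := by nlinarith
  rw [pairMGF σ w hw hσ ρ _ _ h0 h1]
  have hR0 : 0 ≤ RR ρ := by unfold RR; positivity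
  have hu : ρ * phi ρ + (1 - ρ ^ 2) * (phi ρ * 0) = RR ρ := by
    simp only [phi, RR]; field_simp; ring
  have hv : ρ * 0 + (1 - ρ ^ 2) * (phi ρ ^ 2 + 0 ^ 2) / 2 = RR ρ / 2 := by
    simp only [phi, RR]; field_simp; ring
  rw [hu, hv]
  refine (quadσ σ w hw hσ (RR ρ) (RR ρ / 2) (-(3 * RR ρ)) (3 * RR ρ) (9 * RR ρ ^ 2) (1 / 2) hR0
    (by linarith) (by linarith) (by linarith) (by linarith) (by linarith)
    (fun l => log_quad _ l hR)).trans (le_of_eq ?_)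
  congr 2; ring

lemma case3 (hw : ∀ i, w i ^ 2 = w i)
    (ρ s : ℝ) (h0 : 0 < ρ) (h1 : ρ < 1) (hR : RR ρ ≤ 1 / 8) (hs0 : 0 ≤ s) (hs1 : s ≤ 1) :
    ∫⁻ ω, ENNReal.ofReal (Real.exp (∑ i, w i * (0 * ((ω i).1 * (ω ((1 : Equiv.Perm ι) i)).2) + (-(s * phi ρ)) * ((ω i).1 * (ω i).2))))
        ∂(Measure.pi fun _ : ι => gaussianPair ρ)
      ≤ ENNReal.ofReal (Real.exp (9 * RR ρ ^ 2 * Fintype.card ι - RR ρ * (s - s ^ 2 / 2) * ∑ i, w i)) := by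
  have hp : 0 < 1 - ρ ^ 2 := by nlinarith
  rw [pairMGF 1 w hw (by simp) ρ _ _ h0 h1]
  have hR0 : 0 ≤ RR ρ := by unfold RR; positivity
  have hu : ρ * 0 + (1 - ρ ^ 2) * (0 * -(s * phi ρ)) = 0 := by ring
  have hv : ρ * -(s * phi ρ) + (1 - ρ ^ 2) * (0 ^ 2 + (-(s * phi ρ)) ^ 2) / 2 = -(RR ρ * (s - s ^ 2 / 2)) := by
    simp only [phi, RR]; field_simp; ring
  rw [hu, hv]
  have a1 : 0 ≤ s - s ^ 2 / 2 := by nlinarith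
  have a2 : s - s ^ 2 / 2 ≤ 1 := by nlinarith
  refine (quadσ 1 w hw (by simp) 0 (-(RR ρ * (s - s ^ 2 / 2))) (-(3 * RR ρ)) (3 * RR ρ) (9 * RR ρ ^ 2) (1 / 2) le_rfl
    (by linarith) (by nlinarith) (by linarith) (by nlinarith) (by linarith)
    (fun l => log_quad _ l hR)).trans (le_of_eq ?_)
  congr 2; ring
end

lemma feat_eq (n d : ℕ) (r : ℝ) :
    (Measure.pi fun _ : Fin n => featurePair d r)
      = (Measure.pi fun _ : Fin n × Fin d => gaussianPair r).map
        (fun ω v => ((fun i => (ω (v, i)).1, fun i => (ω (v, i)).2) : (Fin d → ℝ) × (Fin d → ℝ))) := by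
  have h1 : featurePair d r = (Measure.pi fun _ : Fin d => gaussianPair r).map
      (fun ω => (fun i => (ω i).1, fun i => (ω i).2)) := by
    unfold featurePair gaussianPair
    rw [← Measure.pi_map_pi (fun i => by fun_prop), Measure.map_map (by fun_prop) (by fun_prop)]
    have hm := (measurePreserving_arrowProdEquivProdArrow ℝ ℝ (Fin d) (fun _ => gaussianReal 0 1)
      (fun _ => gaussianReal 0 1))
    rw [← hm.map_eq, Measure.map_map (by fun_prop) hm.measurable]
    rfl
  have h2 := Measure.infinitePi_map_curry (ι := Fin n) (κ := Fin d) (X := ℝ × ℝ) (fun _ _ => gaussianPair r)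
  simp only [Measure.infinitePi_eq_pi] at h2
  have : IsProbabilityMeasure ((Measure.pi fun _ : Fin d => gaussianPair r).map
      (fun ω => (fun i => (ω i).1, fun i => (ω i).2))) := Measure.isProbabilityMeasure_map (by fun_prop)
  rw [h1, ← Measure.pi_map_pi (fun i => by fun_prop), ← h2, Measure.map_map (by fun_prop) (by fun_prop)]
  rfl

/-- edge permutation induced by a vertex permutation -/
def edgePerm {n : ℕ} (σ : Equiv.Perm (Fin n)) : Equiv.Perm (Edge n) where
  toFun := edgeMap σ
  invFun := edgeMap σ⁻¹
  left_inv e := by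
    apply Subtype.ext
    obtain ⟨e, he⟩ := e
    induction e using Sym2.ind with
    | _ x y => simp [edgeMap]
  right_inv e := by
    apply Subtype.ext
    obtain ⟨e, he⟩ := e
    induction e using Sym2.ind with
    | _ x y => simp [edgeMap]

lemma edgePerm_apply {n : ℕ} (σ : Equiv.Perm (Fin n)) (e : Edge n) : edgePerm σ e = edgeMap σ e := rfl

open Classical in
/-- edge weight: indicator of touching `K` -/
noncomputable def wE {n : ℕ} (K : Finset (Fin n)) (e : Edge n) : ℝ := if ∃ v ∈ K, v ∈ e.1 then 1 else 0

/-- vertex weight: indicator of `K` -/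
noncomputable def wV {n : ℕ} (K : Finset (Fin n)) (v : Fin n) : ℝ := if v ∈ K then 1 else 0

lemma wE_sq {n : ℕ} (K : Finset (Fin n)) (e : Edge n) : wE K e ^ 2 = wE K e := by
  unfold wE; split_ifs <;> simp

lemma wV_sq {n : ℕ} (K : Finset (Fin n)) (e : Fin n) : wV K e ^ 2 = wV K e := by
  unfold wV; split_ifs <;> simp

lemma wV_inv {n : ℕ} (σ : Equiv.Perm (Fin n)) (v : Fin n) : wV σ.support (σ v) = wV σ.support v := by
  unfold wV; simp

lemma wE_inv {n : ℕ} (σ : Equiv.Perm (Fin n)) (e : Edge n) :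
    wE σ.support (edgePerm σ e) = wE σ.support e := by
  unfold wE
  congr 1
  rw [edgePerm_apply]
  simp only [edgeMap, Sym2.mem_map, eq_iff_iff]
  constructor
  · rintro ⟨v, hv, a, ha, rfl⟩
    exact ⟨a, by simpa using hv, ha⟩
  · rintro ⟨v, hv, ha⟩
    exact ⟨σ v, by simpa using hv, v, ha, rfl⟩

lemma sum_wV {n : ℕ} (K : Finset (Fin n)) : ∑ v, wV K v = K.card := by
  simp [wV]

lemma sum_wV_prod {n : ℕ} (K : Finset (Fin n)) (d : ℕ) : ∑ p : Fin n × Fin d, wV K p.1 = K.card * d := by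
  rw [Fintype.sum_prod_type, ← sum_wV, Finset.sum_mul]
  refine Finset.sum_congr rfl fun i _ => ?_
  simp [mul_comm]

lemma card_edge (n : ℕ) : (Fintype.card (Edge n) : ℝ) = (n : ℝ) * (n - 1) / 2 := by
  have : Fintype.card (Edge n) = n.choose 2 := by
    rw [Sym2.card_subtype_not_diag]; simp
  rw [this, Nat.cast_choose_two]

lemma sum_wE {n : ℕ} (K : Finset (Fin n)) :
    (K.card : ℝ) * (2 * n - K.card - 1) / 2 ≤ ∑ e, wE K e := by
  classical
  have h1 : ∑ e, wE K e + ∑ e, (1 - wE K e) = Fintype.card (Edge n) := by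
    rw [← Finset.sum_add_distrib]; simp
  have h2 : ∑ e, (1 - wE K e) = ((Finset.univ.filter fun e : Edge n => ¬ ∃ v ∈ K, v ∈ e.1).card : ℝ) := by
    rw [Finset.card_filter]; push_cast
    refine Finset.sum_congr rfl fun e _ => ?_
    unfold wE; split_ifs <;> simp
  have h3 : (Finset.univ.filter fun e : Edge n => ¬ ∃ v ∈ K, v ∈ e.1).card ≤ (Kᶜ.card).choose 2 := by
    rw [← Sym2.card_image_offDiag]
    refine Finset.card_le_card_of_injOn (fun e => e.1) ?_ (fun a _ b _ h => Subtype.ext h)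
    rintro ⟨e, he⟩ h
    induction e using Sym2.ind with
    | _ x y =>
      simp at h he ⊢
      refine ⟨x, y, ⟨?_, ?_, he⟩, Or.inl ⟨rfl, rfl⟩⟩
      · intro hx; exact (h x hx).1 rfl
      · intro hy; exact (h y hy).2 rfl
  have hk : K.card ≤ n := by simpa using K.card_le_univ
  have h4 : ((Kᶜ.card).choose 2 : ℝ) = ((n : ℝ) - K.card) * (n - K.card - 1) / 2 := by
    rw [Nat.cast_choose_two, Finset.card_compl, Fintype.card_fin, Nat.cast_sub hk]
  have h5 : ((Finset.univ.filter fun e : Edge n => ¬ ∃ v ∈ K, v ∈ e.1).card : ℝ) ≤ ((Kᶜ.card).choose 2 : ℝ) := by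
    exact_mod_cast h3
  rw [h2, card_edge] at h1
  rw [h4] at h5
  nlinarith

lemma sum_fix {n : ℕ} (σ : Equiv.Perm (Fin n)) :
    ∑ e with edgePerm σ e = e, wE σ.support e ≤ σ.support.card := by
  classical
  have h1 : ∑ e with edgePerm σ e = e, wE σ.support e
      = ((Finset.univ.filter fun e : Edge n => edgePerm σ e = e ∧ ∃ v ∈ σ.support, v ∈ e.1).card : ℝ) := by
    rw [← Finset.filter_filter, Finset.card_filter]; push_cast
    refine Finset.sum_congr rfl fun e _ => ?_
    unfold wE; rfl
  rw [h1]
  have h2 : (Finset.univ.filter fun e : Edge n => edgePerm σ e = e ∧ ∃ v ∈ σ.support, v ∈ e.1).card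
      ≤ (σ.support.image fun v => s(v, σ v)).card := by
    refine Finset.card_le_card_of_injOn (fun e => e.1) ?_ (fun a _ b _ h => Subtype.ext h)
    rintro ⟨e, he⟩ h
    obtain ⟨hfix, v, hv, hve⟩ := (Finset.mem_filter.1 (Finset.mem_coe.1 h)).2
    replace hfix : Sym2.map σ e = e := congrArg Subtype.val hfix
    simp only [Finset.coe_image, Set.mem_image, Finset.mem_coe]
    refine ⟨v, hv, ?_⟩
    have hv2 : σ v ∈ e := by
      rw [← hfix]; exact Sym2.mem_map.2 ⟨v, hve, rfl⟩
    have hne : v ≠ σ v := fun h => (Equiv.Perm.mem_support.1 hv) h.symm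
    exact ((Sym2.mem_and_mem_iff hne).1 ⟨hve, hv2⟩).symm
  exact_mod_cast h2.trans Finset.card_image_le

lemma moved_edges {n : ℕ} (σ : Equiv.Perm (Fin n)) :
    ∑ e, wE σ.support e - σ.support.card ≤ ((Finset.univ.filter fun e => edgePerm σ e ≠ e).card : ℝ) := by
  classical
  have h := sum_fix σ
  have h2 : ∑ e, wE σ.support e = ∑ e with edgePerm σ e = e, wE σ.support e
      + ∑ e with ¬ edgePerm σ e = e, wE σ.support e :=
    (Finset.sum_filter_add_sum_filter_not _ _ _).symm
  have h3 : ∑ e with ¬ edgePerm σ e = e, wE σ.support e ≤ ((Finset.univ.filter fun e => edgePerm σ e ≠ e).card : ℝ) := by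
    rw [Finset.card_eq_sum_ones]; push_cast
    refine Finset.sum_le_sum fun e _ => ?_
    unfold wE; split_ifs <;> simp
  linarith

/-- weighted similarity in latent coordinates -/
noncomputable def AA {n d : ℕ} (ρ r : ℝ) (σ : Equiv.Perm (Fin n)) (we : Edge n → ℝ) (wv : Fin n → ℝ)
    (ω : (Edge n → ℝ × ℝ) × (Fin n → (Fin d → ℝ) × (Fin d → ℝ))) : ℝ :=
  ∑ e, we e * (phi ρ * ((ω.1 e).1 * (ω.1 (edgePerm σ e)).2))
    + ∑ v, wv v * ∑ i, phi r * ((ω.2 v).1 i * (ω.2 (σ v)).2 i)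

lemma featMGF {n d : ℕ} (r a b : ℝ) (σ : Equiv.Perm (Fin n)) (w : Fin n → ℝ) :
    ∫⁻ ω, ENNReal.ofReal (Real.exp (∑ v, w v * ∑ i, (a * ((ω v).1 i * (ω (σ v)).2 i) + b * ((ω v).1 i * (ω v).2 i))))
        ∂(Measure.pi fun _ : Fin n => featurePair d r)
      = ∫⁻ ω, ENNReal.ofReal (Real.exp (∑ p : Fin n × Fin d, w p.1 * (a * ((ω p).1 * (ω ((Equiv.prodCongr σ (Equiv.refl _) : Equiv.Perm (Fin n × Fin d)) p)).2) + b * ((ω p).1 * (ω p).2))))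
        ∂(Measure.pi fun _ : Fin n × Fin d => gaussianPair r) := by
  rw [feat_eq, lintegral_map (by fun_prop) (by fun_prop)]
  refine lintegral_congr fun ω => ?_
  rw [Fintype.sum_prod_type]
  simp only [Finset.mul_sum]
  rfl

instance (d : ℕ) (r : ℝ) : IsProbabilityMeasure (featurePair d r) :=
  Measure.isProbabilityMeasure_map (by fun_prop)

instance (n d : ℕ) (ρ r : ℝ) : IsProbabilityMeasure (sample n d ρ r) := by
  unfold sample; infer_instance

lemma markov_prod (n d : ℕ) (ρ r : ℝ) (f : (Edge n → ℝ × ℝ) → ℝ) (g : (Fin n → (Fin d → ℝ) × (Fin d → ℝ)) → ℝ)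
    (hf : Measurable f) (hg : Measurable g) (c bf bg : ℝ)
    (h1 : ∫⁻ ω, ENNReal.ofReal (Real.exp (f ω)) ∂(Measure.pi fun _ : Edge n => gaussianPair ρ) ≤ ENNReal.ofReal (Real.exp bf))
    (h2 : ∫⁻ ω, ENNReal.ofReal (Real.exp (g ω)) ∂(Measure.pi fun _ : Fin n => featurePair d r) ≤ ENNReal.ofReal (Real.exp bg)) :
    sample n d ρ r {ω | 0 ≤ f ω.1 + g ω.2 + c} ≤ ENNReal.ofReal (Real.exp (bf + bg + c)) := by
  have hm := meas_ge_le_lintegral_div (μ := sample n d ρ r) (f := fun ω => ENNReal.ofReal (Real.exp (f ω.1 + g ω.2 + c)))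
    (ε := 1) (by fun_prop) one_ne_zero ENNReal.one_ne_top
  rw [div_one] at hm
  calc _ ≤ _ := measure_mono ?_
    _ ≤ _ := hm
    _ = (∫⁻ ω, ENNReal.ofReal (Real.exp (f ω)) ∂(Measure.pi fun _ : Edge n => gaussianPair ρ))
        * (∫⁻ ω, ENNReal.ofReal (Real.exp (g ω)) ∂(Measure.pi fun _ : Fin n => featurePair d r)) * ENNReal.ofReal (Real.exp c) := by
      unfold sample
      rw [← lintegral_prod_mul (by fun_prop) (by fun_prop), ← lintegral_mul_const _ (by fun_prop)]
      refine lintegral_congr fun ω => ?_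
      rw [← ENNReal.ofReal_mul (by positivity), ← ENNReal.ofReal_mul (by positivity), Real.exp_add, Real.exp_add]
    _ ≤ ENNReal.ofReal (Real.exp bf) * ENNReal.ofReal (Real.exp bg) * ENNReal.ofReal (Real.exp c) := by gcongr
    _ = _ := by
      rw [← ENNReal.ofReal_mul (by positivity), ← ENNReal.ofReal_mul (by positivity), Real.exp_add, Real.exp_add]
  intro ω hω
  simp only [Set.mem_ofPred_eq, ENNReal.one_le_ofReal] at hω ⊢
  exact Real.one_le_exp hω

lemma prob1 {n d : ℕ} (ρ r : ℝ) (h0 : 0 < ρ) (h1 : ρ < 1) (h0' : 0 < r) (h1' : r < 1) (σ : Equiv.Perm (Fin n)) :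
    sample n d ρ r {ω | AA ρ r 1 (fun _ => 1) (fun _ => 1) ω ≤ AA ρ r σ (fun _ => 1) (fun _ => 1) ω}
      ≤ ENNReal.ofReal (Real.exp (-(LL ρ / 4 * (Finset.univ.filter fun e => edgePerm σ e ≠ e).card)
        + -(LL r / 4 * (σ.support.card * d)) + 0)) := by
  classical
  have hf := case1 (Equiv.prodCongr σ (Equiv.refl _) : Equiv.Perm (Fin n × Fin d)) r h0' h1'
  rw [← featMGF r _ _ σ (fun _ => 1)] at hf
  have hc : ((Finset.univ.filter fun p : Fin n × Fin d => (Equiv.prodCongr σ (Equiv.refl _) : Equiv.Perm (Fin n × Fin d)) p ≠ p).card : ℝ)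
      = σ.support.card * d := by
    have : (Finset.univ.filter fun p : Fin n × Fin d => (Equiv.prodCongr σ (Equiv.refl _) : Equiv.Perm (Fin n × Fin d)) p ≠ p)
       = σ.support ×ˢ Finset.univ := by
      ext ⟨v, i⟩; simp [Prod.ext_iff]
    rw [this]; simp
  rw [hc] at hf
  refine le_trans (measure_mono ?_) (markov_prod n d ρ r _ _ (by fun_prop) (by fun_prop) 0 _ _ (case1 (edgePerm σ) ρ h0 h1) hf)
  intro ω hω
  simp only [Set.mem_ofPred_eq, AA] at hω ⊢
  have e1 : edgePerm (1 : Equiv.Perm (Fin n)) = 1 := by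
    ext e; simp [edgePerm_apply, edgeMap]
  rw [e1] at hω
  simp only [one_mul, Equiv.Perm.one_apply] at hω ⊢
  rw [← sub_nonneg] at hω
  have := div_nonneg hω (zero_le_two)
  refine this.trans_eq ?_
  simp only [Finset.sum_add_distrib, ← Finset.mul_sum]
  ring

lemma edgePerm_one {n : ℕ} : edgePerm (1 : Equiv.Perm (Fin n)) = 1 := by
  ext e; simp [edgePerm_apply, edgeMap]

lemma prob2 {n d : ℕ} (ρ r : ℝ) (h0 : 0 < ρ) (h1 : ρ < 1) (h0' : 0 < r) (h1' : r < 1)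
    (hR : RR ρ ≤ 1 / 8) (hR' : RR r ≤ 1 / 8) (σ : Equiv.Perm (Fin n)) (τ : ℝ) :
    sample n d ρ r {ω | τ ≤ AA ρ r σ (wE σ.support) (wV σ.support) ω}
      ≤ ENNReal.ofReal (Real.exp ((9 * RR ρ ^ 2 * Fintype.card (Edge n) + RR ρ * σ.support.card + RR ρ / 2 * ∑ e, wE σ.support e)
        + (9 * RR r ^ 2 * (n * d) + RR r / 2 * (σ.support.card * d)) + -τ)) := by
  classical
  have hf := case2 (Equiv.prodCongr σ (Equiv.refl _) : Equiv.Perm (Fin n × Fin d)) (fun p => wV σ.support p.1)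
    (fun p => wV_sq _ _) (fun p => wV_inv σ p.1) r h0' h1' hR'
  rw [← featMGF r _ _ σ (wV σ.support)] at hf
  have hc : ∑ p : Fin n × Fin d with (Equiv.prodCongr σ (Equiv.refl _) : Equiv.Perm (Fin n × Fin d)) p = p, wV σ.support p.1 = 0 := by
    refine Finset.sum_eq_zero ?_
    rintro ⟨v, i⟩ h
    simp only [Finset.mem_filter, Finset.mem_univ, true_and, Equiv.prodCongr_apply, Prod.map_apply, Prod.mk.injEq] at h
    simp [wV, h.1]
  have hc2 : ∑ p : Fin n × Fin d, wV σ.support p.1 = σ.support.card * d := by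
    exact sum_wV_prod _ _
  rw [hc, hc2] at hf
  have he := case2 (edgePerm σ) (wE σ.support) (wE_sq _) (wE_inv σ) ρ h0 h1 hR
  have he' := he.trans (ENNReal.ofReal_le_ofReal (Real.exp_le_exp.mpr (show _ ≤ 9 * RR ρ ^ 2 * Fintype.card (Edge n) + RR ρ * σ.support.card + RR ρ / 2 * ∑ e, wE σ.support e by
    have hR0 : 0 ≤ RR ρ := by unfold RR; exact div_nonneg (sq_nonneg _) (by nlinarith)
    have := mul_le_mul_of_nonneg_left (sum_fix σ) hR0
    linarith)))
  refine le_trans (measure_mono ?_) ((markov_prod n d ρ r _ _ (by fun_prop) (by fun_prop) (-τ) _ _ he' hf).trans_eq ?_)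
  · intro ω hω
    simp only [Set.mem_ofPred_eq, AA] at hω ⊢
    simp only [zero_mul, add_zero]
    linarith
  · simp

lemma prob3 {n d : ℕ} (ρ r : ℝ) (h0 : 0 < ρ) (h1 : ρ < 1) (h0' : 0 < r) (h1' : r < 1)
    (hR : RR ρ ≤ 1 / 8) (hR' : RR r ≤ 1 / 8) (K : Finset (Fin n)) (τ s : ℝ) (hs0 : 0 ≤ s) (hs1 : s ≤ 1) :
    sample n d ρ r {ω | AA ρ r 1 (wE K) (wV K) ω ≤ τ}
      ≤ ENNReal.ofReal (Real.exp ((9 * RR ρ ^ 2 * Fintype.card (Edge n) - RR ρ * (s - s ^ 2 / 2) * ∑ e, wE K e)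
        + (9 * RR r ^ 2 * (n * d) - RR r * (s - s ^ 2 / 2) * (K.card * d)) + s * τ)) := by
  classical
  have hf := case3 (ι := Fin n × Fin d) (fun p => wV K p.1)
    (fun p => wV_sq _ _) r s h0' h1' hR' hs0 hs1
  have e1 : (1 : Equiv.Perm (Fin n × Fin d)) = (Equiv.prodCongr (1 : Equiv.Perm (Fin n)) (Equiv.refl _) : Equiv.Perm (Fin n × Fin d)) := by
    ext p <;> simp
  rw [e1, ← featMGF r _ _ 1 (wV K)] at hf
  have hc2 : ∑ p : Fin n × Fin d, wV K p.1 = K.card * d := by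
    exact sum_wV_prod _ _
  rw [hc2] at hf
  have he := case3 (wE K) (wE_sq _) ρ s h0 h1 hR hs0 hs1
  refine le_trans (measure_mono ?_) ((markov_prod n d ρ r _ _ (by fun_prop) (by fun_prop) (s * τ) _ _ he hf).trans_eq ?_)
  · intro ω hω
    simp only [Set.mem_ofPred_eq, AA, edgePerm_one] at hω ⊢
    simp only [zero_mul, zero_add, Equiv.Perm.one_apply] at hω ⊢
    have := mul_le_mul_of_nonneg_left hω hs0
    rw [← sub_nonneg] at this
    refine this.trans_eq ?_
    simp only [mul_add, Finset.mul_sum, sub_eq_add_neg, neg_add, ← Finset.sum_neg_distrib]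
    rw [add_comm]
    congr 2
    · refine Finset.sum_congr rfl fun i _ => by ring
    · refine Finset.sum_congr rfl fun i _ => Finset.sum_congr rfl fun j _ => by ring
  · simp

lemma card_perm_support {n : ℕ} (K : Finset (Fin n)) :
    (Finset.univ.filter fun σ : Equiv.Perm (Fin n) => σ.support = K).card ≤ K.card.factorial := by
  classical
  have h1 : Fintype.card {f : Equiv.Perm (Fin n) // ∀ a, ¬ a ∈ K → f a = a} = K.card.factorial := by
    rw [← Fintype.card_congr (Equiv.Perm.subtypeEquivSubtypePerm (fun a => a ∈ K)), Fintype.card_perm]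
    simp
  rw [← h1, Fintype.card_subtype]
  refine Finset.card_le_card fun σ hσ => ?_
  simp only [Finset.mem_filter, Finset.mem_univ, true_and] at hσ ⊢
  intro a ha
  rw [← hσ] at ha
  simpa using ha

lemma perm_sum (n : ℕ) (z : ℝ) (hz : 0 ≤ z) (hnz : n * z ≤ 1 / 2) :
    ∑ σ : Equiv.Perm (Fin n) with σ ≠ 1, z ^ σ.support.card ≤ 2 * (n * z) := by
  classical
  have h1 : ∑ σ : Equiv.Perm (Fin n), z ^ σ.support.card ≤ ∑ K : Finset (Fin n), (K.card.factorial : ℝ) * z ^ K.card := by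
    rw [← Finset.sum_fiberwise Finset.univ (fun σ : Equiv.Perm (Fin n) => σ.support)]
    refine Finset.sum_le_sum fun K _ => ?_
    rw [Finset.sum_congr rfl (g := fun _ => z ^ K.card) (fun σ hσ => by rw [(Finset.mem_filter.1 hσ).2]),
      Finset.sum_const, nsmul_eq_mul]
    gcongr
    exact card_perm_support K
  have h2 : ∑ K : Finset (Fin n), (K.card.factorial : ℝ) * z ^ K.card
      = ∑ k ∈ Finset.range (n + 1), (n.choose k : ℝ) * ((k.factorial : ℝ) * z ^ k) := by
    have := Finset.sum_powerset_apply_card (fun k => (k.factorial : ℝ) * z ^ k) (x := (Finset.univ : Finset (Fin n)))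
    simpa using this
  have h3 : ∑ k ∈ Finset.range (n + 1), (n.choose k : ℝ) * ((k.factorial : ℝ) * z ^ k)
      ≤ ∑ k ∈ Finset.range (n + 1), (n * z) ^ k := by
    refine Finset.sum_le_sum fun k _ => ?_
    have : (n.choose k : ℝ) * (k.factorial : ℝ) ≤ (n : ℝ) ^ k := by
      have h := Nat.descFactorial_le_pow n k
      rw [Nat.descFactorial_eq_factorial_mul_choose] at h
      rw [mul_comm]; exact_mod_cast h
    rw [← mul_assoc, mul_pow]
    gcongr
  have hq0 : 0 ≤ n * z := by positivity
  have h4 : ∑ k ∈ Finset.range (n + 1), (n * z) ^ k ≤ 1 + 2 * (n * z) := by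
    rw [Finset.sum_range_succ', pow_zero, add_comm]
    simp_rw [pow_succ']
    rw [← Finset.mul_sum]
    have : ∑ k ∈ Finset.range n, (n * z) ^ k ≤ 2 := by
      calc _ ≤ (1 - n * z)⁻¹ := by
            rw [← tsum_geometric_of_lt_one hq0 (by linarith)]
            exact (summable_geometric_of_lt_one hq0 (by linarith)).sum_le_tsum _ (fun i _ => by positivity)
        _ ≤ 2 := by
            rw [inv_le_comm₀ (by linarith) (by norm_num)]; linarith
    nlinarith
  have h5 : ∑ σ : Equiv.Perm (Fin n), z ^ σ.support.card
      = ∑ σ : Equiv.Perm (Fin n) with σ ≠ 1, z ^ σ.support.card + 1 := by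
    rw [← Finset.sum_filter_add_sum_filter_not Finset.univ (fun σ : Equiv.Perm (Fin n) => σ ≠ 1)]
    congr 1
    have : (Finset.univ.filter fun σ : Equiv.Perm (Fin n) => ¬ σ ≠ 1) = {1} := by ext; simp
    rw [this]; simp
  linarith

lemma AA_diff {n d : ℕ} (ρ r : ℝ) (σ : Equiv.Perm (Fin n))
    (ω : (Edge n → ℝ × ℝ) × (Fin n → (Fin d → ℝ) × (Fin d → ℝ))) :
    AA ρ r σ (fun _ => 1) (fun _ => 1) ω - AA ρ r 1 (fun _ => 1) (fun _ => 1) ω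
      = AA ρ r σ (wE σ.support) (wV σ.support) ω - AA ρ r 1 (wE σ.support) (wV σ.support) ω := by
  simp only [AA, edgePerm_one, Equiv.Perm.one_apply]
  rw [add_sub_add_comm, add_sub_add_comm]
  simp only [← Finset.sum_sub_distrib]
  congr 1
  · refine Finset.sum_congr rfl fun e _ => ?_
    by_cases h : ∃ v ∈ σ.support, v ∈ e.1
    · simp only [wE, if_pos h]
    · have : edgePerm σ e = e := by
        apply Subtype.ext
        obtain ⟨e, he⟩ := e
        induction e using Sym2.ind with
        | _ x y =>
          simp [edgePerm_apply, edgeMap] at h ⊢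
          left
          refine ⟨by_contra fun hx => (h x hx).1 rfl, by_contra fun hx => (h y hx).2 rfl⟩
      rw [this]; simp
  · refine Finset.sum_congr rfl fun v _ => ?_
    by_cases h : v ∈ σ.support
    · simp only [wV, h, if_true]
    · have : σ v = v := by simpa using h
      rw [this]; simp

/-- the bad event -/
def Bad {n d : ℕ} (ρ r : ℝ) : Set ((Edge n → ℝ × ℝ) × (Fin n → (Fin d → ℝ) × (Fin d → ℝ))) :=
  {ω | ∃ σ : Equiv.Perm (Fin n), σ ≠ 1 ∧ AA ρ r 1 (fun _ => 1) (fun _ => 1) ω ≤ AA ρ r σ (fun _ => 1) (fun _ => 1) ω}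

lemma bad_bound {n d : ℕ} (ρ r g h δ : ℝ) (τ : Finset (Fin n) → ℝ)
    (h1 : ∀ σ : Equiv.Perm (Fin n), σ ≠ 1 → (σ.support.card : ℝ) ≤ δ * n →
      sample n d ρ r {ω | AA ρ r 1 (fun _ => 1) (fun _ => 1) ω ≤ AA ρ r σ (fun _ => 1) (fun _ => 1) ω}
        ≤ ENNReal.ofReal (Real.exp (-(σ.support.card * g))))
    (h2 : ∀ σ : Equiv.Perm (Fin n), δ * n < (σ.support.card : ℝ) →
      sample n d ρ r {ω | τ σ.support ≤ AA ρ r σ (wE σ.support) (wV σ.support) ω}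
        ≤ ENNReal.ofReal (Real.exp (-(σ.support.card * g))))
    (h3 : ∀ K : Finset (Fin n), δ * n < (K.card : ℝ) →
      sample n d ρ r {ω | AA ρ r 1 (wE K) (wV K) ω ≤ τ K} ≤ ENNReal.ofReal (Real.exp (-h)))
    (hg : n * Real.exp (-g) ≤ 1 / 2) :
    sample n d ρ r (Bad ρ r) ≤ ENNReal.ofReal (2 * (n * Real.exp (-g)) + 2 ^ n * Real.exp (-h)) := by
  classical
  set Bσ : Equiv.Perm (Fin n) → Set ((Edge n → ℝ × ℝ) × (Fin n → (Fin d → ℝ) × (Fin d → ℝ))) := fun σ =>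
    if (σ.support.card : ℝ) ≤ δ * n then
      {ω | AA ρ r 1 (fun _ => 1) (fun _ => 1) ω ≤ AA ρ r σ (fun _ => 1) (fun _ => 1) ω}
    else {ω | τ σ.support ≤ AA ρ r σ (wE σ.support) (wV σ.support) ω} with hBσ
  set CK : Finset (Fin n) → Set ((Edge n → ℝ × ℝ) × (Fin n → (Fin d → ℝ) × (Fin d → ℝ))) := fun K =>
    if δ * n < (K.card : ℝ) then {ω | AA ρ r 1 (wE K) (wV K) ω ≤ τ K} else ∅ with hCK
  have hsub : Bad ρ r ⊆ (⋃ σ ∈ Finset.univ.filter (fun σ : Equiv.Perm (Fin n) => σ ≠ 1), Bσ σ)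
      ∪ (⋃ K ∈ (Finset.univ : Finset (Finset (Fin n))), CK K) := by
    rintro ω ⟨σ, hσ, hle⟩
    by_cases hk : (σ.support.card : ℝ) ≤ δ * n
    · left
      simp only [Set.mem_iUnion]
      refine ⟨σ, by simp [hσ], ?_⟩
      simp only [hBσ, hk, if_true]; exact hle
    · by_cases ht : τ σ.support ≤ AA ρ r σ (wE σ.support) (wV σ.support) ω
      · left
        simp only [Set.mem_iUnion]
        refine ⟨σ, by simp [hσ], ?_⟩
        simp only [hBσ, hk, if_false]; exact ht
      · right
        simp only [Set.mem_iUnion]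
        refine ⟨σ.support, by simp, ?_⟩
        have hk' := not_le.1 hk
        simp only [hCK, hk', if_true]
        have := AA_diff ρ r σ ω
        push Not at ht
        show AA ρ r 1 (wE σ.support) (wV σ.support) ω ≤ τ σ.support
        linarith
  have hb1 : ∀ σ : Equiv.Perm (Fin n), σ ≠ 1 → sample n d ρ r (Bσ σ) ≤ ENNReal.ofReal (Real.exp (-g) ^ σ.support.card) := by
    intro σ hσ
    have e : Real.exp (-g) ^ σ.support.card = Real.exp (-(σ.support.card * g)) := by
      rw [← Real.exp_nat_mul]; congr 1; ring
    rw [e]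
    by_cases hk : (σ.support.card : ℝ) ≤ δ * n
    · simp only [hBσ, hk, if_true]; exact h1 σ hσ hk
    · simp only [hBσ, hk, if_false]; exact h2 σ (not_le.1 hk)
  have hb2 : ∀ K, sample n d ρ r (CK K) ≤ ENNReal.ofReal (Real.exp (-h)) := by
    intro K
    by_cases hk : δ * n < (K.card : ℝ)
    · simp only [hCK, hk, if_true]; exact h3 K hk
    · simp only [hCK, hk, if_false]; simp
  calc _ ≤ _ := measure_mono hsub
    _ ≤ _ := measure_union_le _ _
    _ ≤ ∑ σ : Equiv.Perm (Fin n) with σ ≠ 1, sample n d ρ r (Bσ σ) + ∑ K : Finset (Fin n), sample n d ρ r (CK K) :=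
      add_le_add (measure_biUnion_finset_le _ _) (measure_biUnion_finset_le _ _)
    _ ≤ ∑ σ : Equiv.Perm (Fin n) with σ ≠ 1, ENNReal.ofReal (Real.exp (-g) ^ σ.support.card)
        + ∑ K : Finset (Fin n), ENNReal.ofReal (Real.exp (-h)) :=
      add_le_add (Finset.sum_le_sum fun σ hσ => hb1 σ (Finset.mem_filter.1 hσ).2) (Finset.sum_le_sum fun K _ => hb2 K)
    _ = ENNReal.ofReal (∑ σ : Equiv.Perm (Fin n) with σ ≠ 1, Real.exp (-g) ^ σ.support.card
        + ∑ K : Finset (Fin n), Real.exp (-h)) := by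
      rw [ENNReal.ofReal_add (Finset.sum_nonneg fun _ _ => by positivity) (Finset.sum_nonneg fun _ _ => by positivity),
        ENNReal.ofReal_sum_of_nonneg (fun _ _ => by positivity), ENNReal.ofReal_sum_of_nonneg (fun _ _ => by positivity)]
    _ ≤ _ := by
      apply ENNReal.ofReal_le_ofReal
      refine add_le_add (perm_sum n _ (Real.exp_pos _).le hg) ?_
      simp

lemma AA_measurable {n d : ℕ} (ρ r : ℝ) (σ : Equiv.Perm (Fin n)) (we : Edge n → ℝ) (wv : Fin n → ℝ) :
    Measurable (AA (d := d) ρ r σ we wv) := by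
  unfold AA; fun_prop

lemma obsOf_measurable {n d : ℕ} (πs : Equiv.Perm (Fin n)) : Measurable (obsOf (d := d) πs) := by
  unfold obsOf; fun_prop

lemma score_measurable {n d : ℕ} (ρ r : ℝ) (π : Equiv.Perm (Fin n)) :
    Measurable (fun o : Obs n d => score ρ r o π) := by
  unfold score; fun_prop

lemma score_obsOf {n d : ℕ} (ρ r : ℝ) (πs π : Equiv.Perm (Fin n))
    (ω : (Edge n → ℝ × ℝ) × (Fin n → (Fin d → ℝ) × (Fin d → ℝ))) :
    score ρ r (obsOf πs ω) π = AA ρ r (πs⁻¹ * π) (fun _ => 1) (fun _ => 1) ω := by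
  have he : ∀ e : Edge n, edgeMap πs⁻¹ (edgeMap π e) = edgePerm (πs⁻¹ * π) e := by
    rintro ⟨e, he⟩
    apply Subtype.ext
    induction e using Sym2.ind with
    | _ x y => simp [edgeMap, edgePerm_apply]
  simp only [score, obsOf, AA, he, one_mul, Finset.mul_sum, Equiv.Perm.mul_apply]

/-- unique maximiser -/
def UU {n d : ℕ} (ρ r : ℝ) (π : Equiv.Perm (Fin n)) : Set (Obs n d) :=
  {o | ∀ π', π' ≠ π → score ρ r o π' < score ρ r o π}

lemma UU_measurable {n d : ℕ} (ρ r : ℝ) (π : Equiv.Perm (Fin n)) : MeasurableSet (UU (d := d) ρ r π) := by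
  have : UU (d := d) ρ r π = ⋂ π' : Equiv.Perm (Fin n), ⋂ _ : π' ≠ π, {o | score ρ r o π' < score ρ r o π} := by
    ext o; simp [UU]
  rw [this]
  exact MeasurableSet.iInter fun π' => MeasurableSet.iInter fun _ =>
    measurableSet_lt (score_measurable ρ r π') (score_measurable ρ r π)

lemma UU_unique {n d : ℕ} (ρ r : ℝ) (π π' : Equiv.Perm (Fin n)) (o : Obs n d) (h : o ∈ UU ρ r π) (h' : o ∈ UU ρ r π') :
    π = π' := by
  by_contra hne
  exact lt_asymm (h π' (Ne.symm hne)) (h' π hne)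

open Classical in
/-- the maximum likelihood estimator (with default value when the maximiser is not unique) -/
noncomputable def mle {n d : ℕ} (ρ r : ℝ) (o : Obs n d) : Equiv.Perm (Fin n) :=
  if h : ∃ π, o ∈ UU ρ r π then h.choose else 1

lemma mle_eq {n d : ℕ} (ρ r : ℝ) (o : Obs n d) (π : Equiv.Perm (Fin n)) (h : o ∈ UU ρ r π) : mle ρ r o = π := by
  have hex : ∃ π, o ∈ UU ρ r π := ⟨π, h⟩
  unfold mle
  rw [dif_pos hex]
  exact UU_unique ρ r _ _ o hex.choose_spec h

lemma mle_measurable {n d : ℕ} (ρ r : ℝ) : Measurable (mle (n := n) (d := d) ρ r) := by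
  classical
  refine measurable_to_countable' fun π => ?_
  by_cases hπ : π = 1
  · have : mle ρ r ⁻¹' {π} = UU (d := d) ρ r π ∪ (⋃ π', UU ρ r π')ᶜ := by
      ext o
      simp only [Set.mem_preimage, Set.mem_singleton_iff, Set.mem_union, Set.mem_compl_iff, Set.mem_iUnion]
      constructor
      · intro h
        by_cases hex : ∃ π, o ∈ UU ρ r π
        · left
          obtain ⟨π', h'⟩ := hex
          rw [mle_eq ρ r o π' h'] at h
          rwa [← h]
        · exact Or.inr hex
      · rintro (h | h)
        · exact mle_eq ρ r o π h
        · rw [mle, dif_neg h, hπ]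
    rw [this]
    exact (UU_measurable _ _ _).union (MeasurableSet.iUnion fun _ => UU_measurable _ _ _).compl
  · have : mle ρ r ⁻¹' {π} = UU (d := d) ρ r π := by
      ext o
      simp only [Set.mem_preimage, Set.mem_singleton_iff]
      constructor
      · intro h
        by_cases hex : ∃ π, o ∈ UU ρ r π
        · obtain ⟨π', h'⟩ := hex
          rw [mle_eq ρ r o π' h'] at h
          rwa [← h]
        · rw [mle, dif_neg hex] at h
          exact absurd h.symm hπ
      · exact mle_eq ρ r o π
    rw [this]; exact UU_measurable _ _ _

lemma success_bound {n d : ℕ} (hn : 0 < n) (ρ r : ℝ) (πs : Equiv.Perm (Fin n)) :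
    1 - sample n d ρ r (Bad ρ r) ≤ obsLaw n d ρ r πs {o : Obs n d | overlap (mle ρ r o) πs = 1} := by
  have h1 : UU ρ r πs ⊆ {o : Obs n d | overlap (mle ρ r o) πs = 1} := by
    intro o ho
    show overlap _ _ = 1
    rw [mle_eq ρ r o πs ho]
    have : (n : ℝ) ≠ 0 := by positivity
    simp [overlap, this]
  refine le_trans ?_ (measure_mono h1)
  rw [obsLaw, Measure.map_apply (obsOf_measurable πs) (UU_measurable _ _ _)]
  have h2 : (Bad ρ r)ᶜ ⊆ obsOf (d := d) πs ⁻¹' UU ρ r πs := by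
    intro ω hω π' hne
    rw [score_obsOf, score_obsOf]
    by_contra hcon
    push Not at hcon
    apply hω
    refine ⟨πs⁻¹ * π', ?_, ?_⟩
    · intro h; exact hne (inv_mul_eq_one.1 h).symm
    · simpa using hcon
  refine le_trans ?_ (measure_mono h2)
  have := measure_add_measure_compl₀ (μ := sample n d ρ r) (s := Bad ρ r) (by
    have : Bad (n := n) (d := d) ρ r = ⋃ σ : Equiv.Perm (Fin n), ⋃ _ : σ ≠ 1, {ω | AA ρ r 1 (fun _ => 1) (fun _ => 1) ω ≤ AA ρ r σ (fun _ => 1) (fun _ => 1) ω} := by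
      ext ω; simp [Bad]
    rw [this]
    exact (MeasurableSet.iUnion fun σ => MeasurableSet.iUnion fun _ =>
      measurableSet_le (AA_measurable _ _ _ _ _) (AA_measurable _ _ _ _ _)).nullMeasurableSet)
  rw [measure_univ] at this
  rw [← this]
  exact tsub_le_iff_left.2 le_rfl

lemma obsLaw_le_one {n d : ℕ} (ρ r : ℝ) (πs : Equiv.Perm (Fin n)) (s : Set (Obs n d)) :
    obsLaw n d ρ r πs s ≤ 1 := by
  have : IsProbabilityMeasure (obsLaw n d ρ r πs) :=
    Measure.isProbabilityMeasure_map (obsOf_measurable πs).aemeasurable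
  exact prob_le_one

lemma LL_facts (x : ℝ) (h0 : 0 < x) (h1 : x < 1) :
    0 ≤ LL x ∧ LL x ≤ RR x ∧ (LL x ≤ 1 → RR x ≤ 2 * LL x) := by
  have hp : 0 < 1 - x ^ 2 := by nlinarith
  have e : 1 / (1 - x ^ 2) = 1 + RR x := by unfold RR; field_simp; ring
  have hR : 0 ≤ RR x := by unfold RR; positivity
  have hL : LL x = Real.log (1 + RR x) := by unfold LL; rw [e]
  have hE : Real.exp (LL x) = 1 + RR x := by rw [hL, Real.exp_log (by linarith)]
  have hL0 : 0 ≤ LL x := by rw [hL]; exact Real.log_nonneg (by linarith)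
  refine ⟨hL0, ?_, ?_⟩
  · have := Real.add_one_le_exp (LL x); linarith
  · intro h
    have := Real.abs_exp_sub_one_sub_id_le (x := LL x) (by rw [abs_of_nonneg hL0]; exact h)
    have := (abs_le.1 this).2
    nlinarith

set_option maxHeartbeats 2000000 in
lemma fixed_bound {n d : ℕ} (ρ r ε δ q l : ℝ) (h0 : 0 < ρ) (h1 : ρ < 1) (h0' : 0 < r) (h1' : r < 1)
    (hε : 0 < ε) (hε1 : ε ≤ 1) (hδ0 : 0 < δ) (hδ1 : δ ≤ 1 / 2) (hδ : (1 - δ) * (4 + ε) = 4 + ε / 2)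
    (hn : (6 : ℝ) ≤ n) (hn3 : 3 ≤ δ * n) (hl : 0 < l) (hd : (0 : ℝ) < d)
    (hqn : 64 * l ≤ q * n) (hqd : 64 * l ≤ q * d) (hq1 : 8 * q ≤ 1) (hq2 : 720 * q ≤ ε * δ) (hq3 : 288 * q ≤ δ ^ 3)
    (hH : (4 + ε) * l ≤ n * LL ρ + d * LL r) (hcl : 1 ≤ δ ^ 2 / 8 * l)
    (hg : n * Real.exp (-((1 + ε / 16) * l - 1)) ≤ 1 / 2) :
    sample n d ρ r (Bad ρ r) ≤ ENNReal.ofReal (2 * (n * Real.exp (-((1 + ε / 16) * l - 1)))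
      + 2 ^ n * Real.exp (-(δ * n * (δ ^ 2 / 8 * l - 1)))) := by
  obtain ⟨hL0, hLR, hRL⟩ := LL_facts ρ h0 h1
  obtain ⟨hL0', hLR', hRL'⟩ := LL_facts r h0' h1'
  have hcardle : ∀ K : Finset (Fin n), (K.card : ℝ) ≤ n := by
    intro K; have := K.card_le_univ; rw [Fintype.card_fin] at this; exact_mod_cast this
  by_cases hA : 32 * l ≤ n * LL ρ + d * LL r
  · refine bad_bound ρ r _ _ 1 (fun _ => 0) ?_ ?_ ?_ hg
    · intro σ _ _
      refine (prob1 ρ r h0 h1 h0' h1' σ).trans (ENNReal.ofReal_le_ofReal (Real.exp_le_exp.2 ?_))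
      have hm := moved_edges σ
      have hw := sum_wE σ.support
      have hk := hcardle σ.support
      set k : ℝ := (σ.support.card : ℝ)
      set m : ℝ := ((Finset.univ.filter fun e => edgePerm σ e ≠ e).card : ℝ)
      have hk0 : 0 ≤ k := by positivity
      have c0 : k * k ≤ k * n := by gcongr
      have c1 : k * 6 ≤ k * n := by gcongr
      have hm2 : k * n / 4 ≤ m := by linarith
      have a1 : LL ρ / 4 * (k * n / 4) ≤ LL ρ / 4 * m := by gcongr
      have a2 : 0 ≤ k * (d * LL r) := by positivity
      have a3 : k * (32 * l) ≤ k * (n * LL ρ + d * LL r) := by gcongr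
      have a4 : 0 ≤ k * l := by positivity
      have a5 : ε * (k * l) ≤ 1 * (k * l) := by gcongr
      linarith
    · intro σ h; exact absurd h (by have := hcardle σ.support; linarith)
    · intro K h; exact absurd h (by have := hcardle K; linarith)
  push Not at hA
  have hn0 : (0 : ℝ) < n := by linarith
  have hLq : LL ρ ≤ q / 2 := by
    have : (0 : ℝ) ≤ d * LL r := by positivity
    have : n * LL ρ ≤ n * (q / 2) := by linarith
    exact le_of_mul_le_mul_left this hn0
  have hLq' : LL r ≤ q / 2 := by
    have : (0 : ℝ) ≤ n * LL ρ := by positivity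
    have : d * LL r ≤ d * (q / 2) := by linarith
    exact le_of_mul_le_mul_left this hd
  have hRq : RR ρ ≤ q := by have := hRL (by linarith); linarith
  have hRq' : RR r ≤ q := by have := hRL' (by linarith); linarith
  have hq0 : 0 ≤ q := by linarith
  have hHH : (4 + ε) * l ≤ n * RR ρ + d * RR r := by
    have : n * LL ρ ≤ n * RR ρ := by gcongr
    have : d * LL r ≤ d * RR r := by gcongr
    linarith
  have hR0 : 0 ≤ RR ρ := hL0.trans hLR
  have hR0' : 0 ≤ RR r := hL0'.trans hLR'
  set R := RR ρ with hRdef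
  set R' := RR r with hRdef'
  have hRH : 0 ≤ n * R + d * R' := by positivity
  -- common bounds
  have hE : ∀ k : ℝ, δ * n < k → δ * (9 * R ^ 2 * Fintype.card (Edge n) + 9 * R' ^ 2 * (n * d)) ≤ 9 * q * (k * (n * R + d * R')) := by
    intro k hk
    rw [card_edge]
    have b1 : R ^ 2 * (n * (n - 1) / 2) ≤ q * (n * (n * R)) := by
      have : R ^ 2 ≤ q * R := by rw [sq]; exact mul_le_mul_of_nonneg_right hRq hR0
      have : R ^ 2 * (n * (n - 1) / 2) ≤ q * R * (n * (n - 1) / 2) := by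
        apply mul_le_mul_of_nonneg_right this
        have : (0 : ℝ) ≤ n - 1 := by linarith
        positivity
      have : q * R * (n * (n - 1) / 2) ≤ q * R * (n * n) := by
        apply mul_le_mul_of_nonneg_left _ (by positivity)
        have : (0 : ℝ) ≤ n * n := by positivity
        linarith
      linarith
    have b2 : R' ^ 2 * (n * d) ≤ q * (n * (d * R')) := by
      have : R' ^ 2 ≤ q * R' := by rw [sq]; exact mul_le_mul_of_nonneg_right hRq' hR0'
      have : R' ^ 2 * (n * d) ≤ q * R' * (n * d) := by gcongr
      linarith
    have b3 : 9 * q * ((δ * n) * (n * R + d * R')) ≤ 9 * q * (k * (n * R + d * R')) := by gcongr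
    have b4 := mul_le_mul_of_nonneg_left (add_le_add b1 b2) hδ0.le
    linarith
  have hT : ∀ K : Finset (Fin n), K.card / 2 * (n * R + d * R' - R) ≤ R * ∑ e, wE K e + R' * (K.card * d) := by
    intro K
    have hw := sum_wE K
    have hk := hcardle K
    set k : ℝ := (K.card : ℝ)
    have hk0 : 0 ≤ k := by positivity
    have c0 : k * k ≤ k * n := by gcongr
    have c1 : k * (n - 1) / 2 ≤ ∑ e, wE K e := by linarith
    have c2 := mul_le_mul_of_nonneg_left c1 hR0
    have c3 : 0 ≤ R' * (k * d) := by positivity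
    linarith
  refine bad_bound ρ r _ _ δ (fun K => (1 - δ / 2) * (R * ∑ e, wE K e + R' * (K.card * d))) ?_ ?_ ?_ hg
  · intro σ _ hkδ
    refine (prob1 ρ r h0 h1 h0' h1' σ).trans (ENNReal.ofReal_le_ofReal (Real.exp_le_exp.2 ?_))
    have hm := moved_edges σ
    have hw := sum_wE σ.support
    set k : ℝ := (σ.support.card : ℝ)
    set m : ℝ := ((Finset.univ.filter fun e => edgePerm σ e ≠ e).card : ℝ)
    have hk0 : 0 ≤ k := by positivity
    have hm2 : k * n * (1 - δ) ≤ m := by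
      have : k * (n * (1 - δ)) ≤ k * (n - k / 2 - 3 / 2) := by
        apply mul_le_mul_of_nonneg_left _ hk0
        linarith
      linarith
    have a1 : LL ρ / 4 * (k * n * (1 - δ)) ≤ LL ρ / 4 * m := by gcongr
    have a2 : 0 ≤ δ * (k * (d * LL r)) := by positivity
    have a3 : k * (1 - δ) * ((4 + ε) * l) ≤ k * (1 - δ) * (n * LL ρ + d * LL r) := by
      have : 0 ≤ 1 - δ := by linarith
      gcongr
    have a4 : 0 ≤ k * l := by positivity
    have a5 : 0 ≤ ε * (k * l) := by positivity
    have a6 : k * (1 - δ) * ((4 + ε) * l) = k * l * (4 + ε / 2) := by rw [← hδ]; ring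
    linarith
  · intro σ hkδ
    refine (prob2 ρ r h0 h1 h0' h1' (by linarith) (by linarith) σ _).trans (ENNReal.ofReal_le_ofReal (Real.exp_le_exp.2 ?_))
    have hT := hT σ.support
    have hE := hE σ.support.card hkδ
    simp only [← hRdef, ← hRdef']
    set k : ℝ := (σ.support.card : ℝ)
    set W : ℝ := ∑ e, wE σ.support e
    set C : ℝ := 9 * R ^ 2 * Fintype.card (Edge n) + 9 * R' ^ 2 * (n * d) with hC
    set H := n * R + d * R'
    have hk0 : 0 ≤ k := by positivity
    have a1 : (1 - δ) / 2 * (k / 2 * (H - R)) ≤ (1 - δ) / 2 * (R * W + R' * (k * d)) := by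
      have : 0 ≤ (1 - δ) / 2 := by linarith
      gcongr
    have a2 : C ≤ ε / 80 * (k * H) := by
      have : 9 * q * (k * H) ≤ δ * (ε / 80 * (k * H)) := by
        have : 9 * q * (k * H) ≤ (ε * δ / 80) * (k * H) := by gcongr; linarith
        linarith
      exact le_of_mul_le_mul_left (hE.trans this) hδ0
    have a3 : k * ((1 - δ) / 4 - ε / 80) * ((4 + ε) * l) ≤ k * ((1 - δ) / 4 - ε / 80) * H := by
      apply mul_le_mul_of_nonneg_left hHH
      apply mul_nonneg hk0; linarith
    have a4 : 0 ≤ k * l := by positivity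
    have a5 : k * l * (1 + ε / 16) ≤ k * ((1 - δ) / 4 - ε / 80) * ((4 + ε) * l) := by
      have e1 : k * ((1 - δ) / 4 - ε / 80) * ((4 + ε) * l) = k * l * ((4 + ε / 2) / 4 - ε / 80 * (4 + ε)) := by
        rw [← hδ]; ring
      rw [e1]
      apply mul_le_mul_of_nonneg_left _ a4
      nlinarith only [hε, hε1]
    have a6 : k * R ≤ k * (1 / 8) := by gcongr; linarith
    have a7 : 0 ≤ δ * (k * R) := by positivity
    linarith
  · intro K hkδ
    refine (prob3 ρ r h0 h1 h0' h1' (by linarith) (by linarith) K _ (δ / 2) (by linarith) (by linarith)).trans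
      (ENNReal.ofReal_le_ofReal (Real.exp_le_exp.2 ?_))
    have hT := hT K
    have hE := hE K.card hkδ
    simp only [← hRdef, ← hRdef']
    set k : ℝ := (K.card : ℝ)
    set W : ℝ := ∑ e, wE K e
    set C : ℝ := 9 * R ^ 2 * Fintype.card (Edge n) + 9 * R' ^ 2 * (n * d) with hC
    set H := n * R + d * R'
    have hk0 : 0 ≤ k := by positivity
    have a1 : δ ^ 2 / 8 * (k / 2 * (H - R)) ≤ δ ^ 2 / 8 * (R * W + R' * (k * d)) := by gcongr
    have a2 : C ≤ δ ^ 2 / 32 * (k * H) := by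
      have : 9 * q * (k * H) ≤ δ * (δ ^ 2 / 32 * (k * H)) := by
        have : 9 * q * (k * H) ≤ (δ ^ 3 / 32) * (k * H) := by gcongr; linarith
        linarith
      exact le_of_mul_le_mul_left (hE.trans this) hδ0
    have a3 : δ ^ 2 / 32 * (k * (4 * l)) ≤ δ ^ 2 / 32 * (k * H) := by
      have : 0 ≤ ε * l := by positivity
      have : 4 * l ≤ H := by linarith
      gcongr
    have a4 : k * R ≤ k * (1 / 8) := by gcongr; linarith
    have a5 : δ ^ 2 / 16 * (k * R) ≤ 1 * (k * R) := by gcongr; exact (by nlinarith only [hδ0, hδ1] : δ ^ 2 / 16 ≤ 1)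
    have a6 : δ * n * (δ ^ 2 / 8 * l - 1) ≤ k * (δ ^ 2 / 8 * l - 1) := by
      apply mul_le_mul_of_nonneg_right hkδ.le; linarith
    have e1 : 9 * R ^ 2 * ↑(Fintype.card (Edge n)) - R * (δ / 2 - (δ / 2) ^ 2 / 2) * W +
        (9 * R' ^ 2 * (↑n * ↑d) - R' * (δ / 2 - (δ / 2) ^ 2 / 2) * (k * ↑d)) +
        δ / 2 * ((1 - δ / 2) * (R * W + R' * (k * ↑d))) = C - δ ^ 2 / 8 * (R * W + R' * (k * d)) := by
      rw [hC]; ring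
    rw [e1]
    linarith

lemma b_tendsto (a δ c : ℝ) (ha : 0 < a) (hδ : 0 < δ) (hc : 0 < c) :
    Tendsto (fun n : ℕ => (n : ℝ) * Real.exp (-((1 + a) * Real.log n - 1))) atTop (nhds 0) ∧
    Tendsto (fun n : ℕ => (2 : ℝ) ^ n * Real.exp (-(δ * n * (c * Real.log n - 1)))) atTop (nhds 0) := by
  have hlog : Tendsto (fun n : ℕ => Real.log n) atTop atTop :=
    Real.tendsto_log_atTop.comp tendsto_natCast_atTop_atTop
  constructor
  · have h1 : Tendsto (fun n : ℕ => Real.exp (-(a * Real.log n + (-1)))) atTop (nhds 0) :=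
      Real.tendsto_exp_neg_atTop_nhds_zero.comp (tendsto_atTop_add_const_right _ _ (hlog.const_mul_atTop ha))
    refine h1.congr' ?_
    filter_upwards [eventually_gt_atTop 0] with n hn
    have hn' : (0 : ℝ) < n := by exact_mod_cast hn
    have e : (n : ℝ) = Real.exp (Real.log n) := (Real.exp_log hn').symm
    conv_rhs => rw [e]
    rw [← Real.exp_add, Real.log_exp]; congr 1; ring
  · have h1 : Tendsto (fun n : ℕ => δ * (c * Real.log n + (-1)) + (- Real.log 2)) atTop atTop :=
      tendsto_atTop_add_const_right _ _
        ((tendsto_atTop_add_const_right _ _ (hlog.const_mul_atTop hc)).const_mul_atTop hδ)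
    have h2 : Tendsto (fun n : ℕ => Real.exp (-((n : ℝ) * (δ * (c * Real.log n + (-1)) + (- Real.log 2))))) atTop (nhds 0) :=
      Real.tendsto_exp_neg_atTop_nhds_zero.comp (tendsto_natCast_atTop_atTop.atTop_mul_atTop₀ h1)
    refine h2.congr fun n => ?_
    have e : (2 : ℝ) ^ n = Real.exp (n * Real.log 2) := by
      rw [Real.exp_nat_mul, Real.exp_log (by norm_num)]
    rw [e, ← Real.exp_add]; congr 1; ring

lemma eventual_bound (d : ℕ → ℕ) (ρ r : ℕ → ℝ) (ε : ℝ)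
    (hρ : ∀ n, 0 < ρ n ∧ ρ n < 1) (hr : ∀ n, 0 < r n ∧ r n < 1)
    (hd : Tendsto (fun n => (d n : ℝ) / Real.log n) atTop atTop)
    (hε : 0 < ε) (hε1 : ε ≤ 1)
    (hthr : ∀ n : ℕ, (4 + ε) * Real.log n ≤ (n : ℝ) * LL (ρ n) + (d n : ℝ) * LL (r n)) :
    ∃ b : ℕ → ℝ, Tendsto b atTop (nhds 0) ∧
      ∀ᶠ n in atTop, sample n (d n) (ρ n) (r n) (Bad (ρ n) (r n)) ≤ ENNReal.ofReal (b n) := by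
  have hlog : Tendsto (fun n : ℕ => Real.log n) atTop atTop :=
    Real.tendsto_log_atTop.comp tendsto_natCast_atTop_atTop
  set δ : ℝ := ε / (2 * (4 + ε)) with hδ
  have hδ0 : 0 < δ := by positivity
  have hδ1 : δ ≤ 1 / 2 := by rw [hδ, div_le_div_iff₀ (by positivity) (by norm_num)]; linarith
  have hδ2 : (1 - δ) * (4 + ε) = 4 + ε / 2 := by rw [hδ]; field_simp; ring
  obtain ⟨hb1, hb2⟩ := b_tendsto (ε / 16) δ (δ ^ 2 / 8) (by positivity) hδ0 (by positivity)
  have hB := (hb1.const_mul 2).add hb2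
  rw [mul_zero, add_zero] at hB
  refine ⟨_, hB, ?_⟩
  have hq1 : Tendsto (fun n : ℕ => Real.log n / (n : ℝ)) atTop (nhds 0) :=
    (Real.isLittleO_log_id_atTop.tendsto_div_nhds_zero).comp tendsto_natCast_atTop_atTop
  have hq2 : Tendsto (fun n : ℕ => Real.log n / (d n : ℝ)) atTop (nhds 0) := by
    refine hd.inv_tendsto_atTop.congr fun n => ?_
    simp
  have hq : Tendsto (fun n : ℕ => 64 * (Real.log n / (n : ℝ)) + 64 * (Real.log n / (d n : ℝ))) atTop (nhds 0) := by
    simpa using (hq1.const_mul 64).add (hq2.const_mul 64)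
  have hqc : ∀ x : ℝ, 0 < x → ∀ᶠ n : ℕ in atTop, 64 * (Real.log n / (n : ℝ)) + 64 * (Real.log n / (d n : ℝ)) ≤ x :=
    fun x hx => hq.eventually (Iic_mem_nhds hx)
  have hnat : Tendsto (fun n : ℕ => (n : ℝ)) atTop atTop := tendsto_natCast_atTop_atTop
  filter_upwards [hqc (1 / 8) (by norm_num), hqc (ε * δ / 720) (by positivity), hqc (δ ^ 3 / 288) (by positivity),
    hnat.eventually_ge_atTop 6, (hnat.const_mul_atTop hδ0).eventually_ge_atTop 3, hlog.eventually_gt_atTop 0,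
    hd.eventually_gt_atTop 0, (hlog.const_mul_atTop (show 0 < δ ^ 2 / 8 by positivity)).eventually_ge_atTop 1,
    hb1.eventually (Iic_mem_nhds (show (0 : ℝ) < 1 / 2 by norm_num))] with n h1 h2 h3 h4 h5 h6 h7 h8 h9
  have hdn : (0 : ℝ) < d n := by
    rcases (Nat.cast_nonneg (α := ℝ) (d n)).eq_or_lt with h | h
    · rw [← h] at h7; simp at h7
    · exact h
  have hn0 : (0 : ℝ) < n := by linarith
  refine fixed_bound (ρ n) (r n) ε δ (64 * (Real.log n / (n : ℝ)) + 64 * (Real.log n / (d n : ℝ))) (Real.log n)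
    (hρ n).1 (hρ n).2 (hr n).1 (hr n).2 hε hε1 hδ0 hδ1 hδ2 h4 h5 h6 hdn ?_ ?_ (by linarith) (by linarith) (by linarith)
    (hthr n) h8 h9
  · have : (64 * (Real.log n / (n : ℝ)) + 64 * (Real.log n / (d n : ℝ))) * n
        = 64 * Real.log n + 64 * (Real.log n / (d n : ℝ)) * n := by field_simp
    rw [this]
    have : 0 ≤ 64 * (Real.log n / (d n : ℝ)) * n := by positivity
    linarith
  · have : (64 * (Real.log n / (n : ℝ)) + 64 * (Real.log n / (d n : ℝ))) * d n
        = 64 * Real.log n + 64 * (Real.log n / (n : ℝ)) * d n := by field_simp; ring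
    rw [this]
    have : 0 ≤ 64 * (Real.log n / (n : ℝ)) * d n := by positivity
    linarith

/-- Theorem: exact recovery, possibility. Under the featured
correlated Gaussian Wigner model, if `d = ω(log n)` and
`n log(1/(1-ρ²)) + d log(1/(1-r²)) ≥ (4+ε) log n`, then there is an estimator
`π̂(G1, G2)` such that for every `π* ∈ S_n`,
`P[overlap(π̂, π*) = 1] = 1 - o(1)` as `n → ∞`. -/
theorem exact_recovery_possible
    (d : ℕ → ℕ) (ρ r : ℕ → ℝ) (ε : ℝ)
    (hρ : ∀ n, 0 < ρ n ∧ ρ n < 1) (hr : ∀ n, 0 < r n ∧ r n < 1)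
    (hd : Tendsto (fun n => (d n : ℝ) / Real.log n) atTop atTop)
    (hε : 0 < ε)
    (hthr : ∀ n : ℕ, (4 + ε) * Real.log n ≤
      (n : ℝ) * Real.log (1 / (1 - ρ n ^ 2)) + (d n : ℝ) * Real.log (1 / (1 - r n ^ 2))) :
    ∃ est : (n : ℕ) → Obs n (d n) → Equiv.Perm (Fin n),
      (∀ n, Measurable (est n)) ∧
      ∀ πs : (n : ℕ) → Equiv.Perm (Fin n),
        Tendsto
          (fun n => obsLaw n (d n) (ρ n) (r n) (πs n)
            {o : Obs n (d n) | overlap (est n o) (πs n) = 1})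
          atTop (nhds 1) := by
  obtain ⟨b, hb, hbad⟩ := eventual_bound d ρ r (min ε 1) hρ hr hd (lt_min hε one_pos) (min_le_right _ _) (fun n => by
    have h1 := hthr n
    have h2 : (4 + min ε 1) * Real.log n ≤ (4 + ε) * Real.log n := by
      have : 0 ≤ Real.log n := Real.log_natCast_nonneg n
      gcongr
      exact min_le_left _ _
    exact h2.trans h1)
  refine ⟨fun n => mle (ρ n) (r n), fun n => mle_measurable _ _, fun πs => ?_⟩
  have hlow : Tendsto (fun n => (1 : ℝ≥0∞) - ENNReal.ofReal (b n)) atTop (nhds 1) := by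
    have h1 := ENNReal.tendsto_ofReal hb
    have h2 := ENNReal.Tendsto.sub (tendsto_const_nhds (x := (1 : ℝ≥0∞)) (f := (atTop : Filter ℕ))) h1 (Or.inl ENNReal.one_ne_top)
    simpa using h2
  refine tendsto_of_tendsto_of_tendsto_of_le_of_le' hlow tendsto_const_nhds ?_
    (Eventually.of_forall fun n => obsLaw_le_one _ _ _ _)
  filter_upwards [hbad, eventually_gt_atTop 0] with n hn hn0
  exact (tsub_le_tsub_left hn 1).trans (success_bound hn0 (ρ n) (r n) (πs n))

end FCGW
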